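/- Let q₁, q₂, q₃ and q₁', q₂', q₃' be nonzero elements of Q_B with q₁q₂q₃ = q₁'q₂'q₃' in ℂ[x₁,x₂,x₃]. Then there exist a permutation σ ∈ S₃ and scalars λ₁, λ₂, λ₃ ∈ ℂ× with λ₁λ₂λ₃ = 1 such that qᵢ' = λᵢ q_{σ(i)} for i = 1,2,3. (Hence the factorization of an element of S_B into three elements of Q_B is unique up to permutation and scaling, identifying ℙ(S_B) with the symmetric cube of ℙ(Q_B) ≅ ℙ¹.) -/

import Mathlib

open MvPolynomial

noncomputable section

/-- `Q_B`: the set of quadratic polynomials `a₁ x₂x₃ + a₂ x₁x₃ + a₃ x₁x₂` with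
`a₁ + a₂ + a₃ = 0`, i.e. the quadrics through the four points `(0,0,1)`, `(0,1,0)`,
`(1,0,0)`, `(1,1,1)`. -/
def QB : Set (MvPolynomial (Fin 3) ℂ) :=
  {q | ∃ a₁ a₂ a₃ : ℂ, a₁ + a₂ + a₃ = 0 ∧
    q = C a₁ * (X 1 * X 2) + C a₂ * (X 0 * X 2) + C a₃ * (X 0 * X 1)}

/-- The pencil `QB` covers the projective line: every `(s, t)` is attained, up to a common nonzero
scalar, by the values of the two generators of the pencil at some point. -/
lemma exists_point_of_pencil (s t : ℂ) :
    ∃ (x : Fin 3 → ℂ) (c : ℂ), c ≠ 0 ∧ x 1 * x 2 - x 0 * x 1 = c * s ∧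
      x 0 * x 2 - x 0 * x 1 = c * t := by
  obtain ⟨k, hk⟩ := Infinite.exists_notMem_finset ({0, -s, -t} : Finset ℂ)
  simp only [Finset.mem_insert, Finset.mem_singleton, not_or] at hk
  obtain ⟨h0, hs, ht⟩ := hk
  refine ⟨![(t + k) * k, (s + k) * k, (s + k) * (t + k)], k * (s + k) * (t + k), ?_, ?_, ?_⟩
  · refine mul_ne_zero (mul_ne_zero h0 fun h => hs ?_) fun h => ht ?_
    · linear_combination h
    · linear_combination h
  · simp; ring
  · simp; ring

/-- If a nonzero element of the pencil `QB` divides a product of nonzero elements of the pencil,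
then it is proportional to one of the factors. -/
lemma exists_eq_C_mul_of_dvd_prod {ι : Type*} {p : MvPolynomial (Fin 3) ℂ} (hp : p ∈ QB)
    (hp0 : p ≠ 0) {s : Finset ι} {q : ι → MvPolynomial (Fin 3) ℂ} (hq : ∀ i, q i ∈ QB)
    (hq0 : ∀ i, q i ≠ 0) (h : p ∣ ∏ i ∈ s, q i) :
    ∃ i ∈ s, ∃ μ : ℂ, μ ≠ 0 ∧ p = C μ * q i := by
  obtain ⟨a, b, d, hsum, rfl⟩ := hp
  obtain rfl : d = -a - b := by linear_combination hsum
  obtain ⟨x, c, hc, hx₁, hx₂⟩ := exists_point_of_pencil (-b) a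
  have hzero : eval x (∏ i ∈ s, q i) = 0 := by
    refine eq_zero_of_zero_dvd ?_
    convert map_dvd (eval x) h using 1
    simp only [map_add, map_mul, eval_C, eval_X]
    linear_combination -a * hx₁ - b * hx₂
  rw [map_prod, Finset.prod_eq_zero_iff] at hzero
  obtain ⟨i, his, hi⟩ := hzero
  refine ⟨i, his, ?_⟩
  have hqi := hq0 i
  obtain ⟨a', b', d', hsum', hqe⟩ := hq i
  obtain rfl : d' = -a' - b' := by linear_combination hsum'
  rw [hqe] at hi hqi ⊢
  simp only [map_add, map_mul, eval_C, eval_X] at hi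
  have hdet : a * b' = b * a' := by
    refine mul_left_cancel₀ hc ?_
    linear_combination hi - a' * hx₁ - b' * hx₂
  obtain ⟨μ, ha, hb⟩ : ∃ μ : ℂ, a = μ * a' ∧ b = μ * b' := by
    by_cases ha' : a' = 0
    · have hb' : b' ≠ 0 := by
        rintro rfl
        exact hqi (by simp [ha'])
      exact ⟨b / b', by field_simp; exact hdet, by field_simp⟩
    · exact ⟨a / a', by field_simp, by field_simp; exact hdet.symm⟩
  subst ha hb
  refine ⟨μ, ?_, ?_⟩
  · rintro rfl
    exact hp0 (by simp)
  · simp only [C_mul, C_sub, C_neg]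
    ring

/-- If `q₁, q₂, q₃` and `q₁', q₂', q₃'` are nonzero elements of `Q_B` with
`q₁q₂q₃ = q₁'q₂'q₃'`, then there are a permutation `σ ∈ S₃` and scalars
`λ₁, λ₂, λ₃ ∈ ℂ×` with `λ₁λ₂λ₃ = 1` such that `qᵢ' = λᵢ q_{σ(i)}` for `i = 1,2,3`.
Hence the factorization of an element of `S_B` into three elements of `Q_B` is unique up
to permutation and scaling. -/
theorem factorization_unique (q q' : Fin 3 → MvPolynomial (Fin 3) ℂ)
    (hq : ∀ i, q i ∈ QB) (hq' : ∀ i, q' i ∈ QB)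
    (hqne : ∀ i, q i ≠ 0) (hq'ne : ∀ i, q' i ≠ 0)
    (heq : q 0 * q 1 * q 2 = q' 0 * q' 1 * q' 2) :
    ∃ (σ : Equiv.Perm (Fin 3)) (lam : Fin 3 → ℂ),
      (∀ i, lam i ≠ 0) ∧ lam 0 * lam 1 * lam 2 = 1 ∧
      ∀ i, q' i = C (lam i) * q (σ i) := by
  have hprod : ∏ i, q i = q' 0 * q' 1 * q' 2 := by rw [Fin.prod_univ_three, heq]
  obtain ⟨i, hi, l, hl, hqi⟩ := exists_eq_C_mul_of_dvd_prod (s := Finset.univ) (hq' 0) (hq'ne 0)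
    hq hqne (hprod ▸ Dvd.intro _ (mul_assoc _ _ _).symm)
  have hprod₁ : ∏ i ∈ Finset.univ.erase i, q i = C l * (q' 1 * q' 2) := by
    refine mul_left_cancel₀ (hqne i) ?_
    rw [Finset.mul_prod_erase _ _ hi, hprod, hqi]
    ring
  obtain ⟨j, hj, m, hm, hqj⟩ := exists_eq_C_mul_of_dvd_prod (s := Finset.univ.erase i) (hq' 1)
    (hq'ne 1) hq hqne (hprod₁ ▸ Dvd.intro (C l * q' 2) (by ring))
  have hprod₂ : ∏ i ∈ (Finset.univ.erase i).erase j, q i = C l * C m * q' 2 := by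
    refine mul_left_cancel₀ (hqne j) ?_
    rw [Finset.mul_prod_erase _ _ hj, hprod₁, hqj]
    ring
  obtain ⟨k, hk⟩ : ∃ k, (Finset.univ.erase i).erase j = {k} := by
    rw [← Finset.card_eq_one, Finset.card_erase_of_mem hj, Finset.card_erase_of_mem hi]
    simp
  have hkmem : k ∈ (Finset.univ.erase i).erase j := by simp [hk]
  simp only [Finset.mem_erase, Finset.mem_univ, and_true] at hj hkmem
  rw [hk, Finset.prod_singleton] at hprod₂
  have hinj : Function.Injective ![i, j, k] := by
    intro a b
    fin_cases a <;> fin_cases b <;> simp [hj, hj.symm, hkmem, hkmem.1.symm, Ne.symm hkmem.2]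
  refine ⟨Equiv.ofBijective _ hinj.bijective_of_finite, ![l, m, (l * m)⁻¹], ?_, ?_, ?_⟩
  · simp [Fin.forall_fin_succ, hl, hm]
  · exact mul_inv_cancel₀ (mul_ne_zero hl hm)
  · have hqk : q' 2 = C (l * m)⁻¹ * q k := by
      rw [hprod₂, ← C_mul, ← mul_assoc, ← C_mul, inv_mul_cancel₀ (mul_ne_zero hl hm), C_1, one_mul]
    intro a
    fin_cases a
    · exact hqi
    · exact hqj
    · exact hqk
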